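/- Let n ≥ 1 and let Z̄_n be the mean of n independent PN(μ_X,μ_Y;σ_X²,σ_Y²;ρ) random variables, and write μ_k = E[(Z̄_n − E[Z̄_n])^k] = E[(Z̄_n − (μ_Xμ_Y + n s_n ρ))^k] (with μ_k = 0 by convention for k < 0, μ_0 = 1 and μ_1 = 0). Then for every integer k ≥ 0: μ_{k+1} = 4ρ s_n k·μ_k − s_n k(s_n(6ρ²−2)(k−1) + n s_n(2ρ r_X r_Y − r_X² − r_Y² + 3ρ² − 1) − 4ρ(μ_Xμ_Y + n s_n ρ))·μ_{k−1} − s_n²k(k−1)((6ρ²−2)(μ_Xμ_Y + n s_n ρ) + n s_n(ρ r_Y² − ρ² r_X r_Y − r_X r_Y + ρ r_X² + 3ρ(1−ρ²)) + 4 s_n ρ(1−ρ²)(k−2))·μ_{k−2} − s_n³(1−ρ²)k(k−1)(k−2)(4ρ(μ_Xμ_Y + n s_n ρ) + s_n(1−ρ²)(n+k−3))·μ_{k−3} − s_n⁴(1−ρ²)²k(k−1)(k−2)(k−3)(μ_Xμ_Y + n s_n ρ)·μ_{k−4}. -/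

import Mathlib

open MeasureTheory ProbabilityTheory

/-- The product-normal law `PN(μX, μY; σX², σY²; ρ)`: the law of `X * Y` where
`X = μX + σX * U`, `Y = μY + σY * (ρ * U + √(1 - ρ²) * V)` and `U, V` are independent
standard normal random variables. -/
noncomputable def PN (μX μY σX σY ρ : ℝ) : Measure ℝ :=
  Measure.map
    (fun p : ℝ × ℝ =>
      (μX + σX * p.1) * (μY + σY * (ρ * p.1 + Real.sqrt (1 - ρ ^ 2) * p.2)))
    ((gaussianReal 0 1).prod (gaussianReal 0 1))

/-- The law of the mean `Z̄ₙ = n⁻¹ ∑ᵢ Zᵢ` of `n` independent random variables with law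
`PN(μX, μY; σX², σY²; ρ)`. -/
noncomputable def PNbar (n : ℕ) (μX μY σX σY ρ : ℝ) : Measure ℝ :=
  Measure.map (fun ω : Fin n → ℝ => (∑ i, ω i) / (n : ℝ))
    (Measure.pi fun _ : Fin n => PN μX μY σX σY ρ)

lemma integrable_and_integral_exp_quadratic_gaussianReal {a : ℝ} (b c : ℝ) (ha : 0 < 1 - 2 * a) :
    Integrable (fun u => Real.exp (a * u ^ 2 + b * u + c)) (gaussianReal 0 1) ∧
      ∫ u, Real.exp (a * u ^ 2 + b * u + c) ∂(gaussianReal 0 1)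
        = Real.exp (c + b ^ 2 / (2 * (1 - 2 * a)) - Real.log (1 - 2 * a) / 2) := by
  set d := 1 - 2 * a with hd
  set v : NNReal := ⟨d⁻¹, (inv_pos.2 ha).le⟩ with hv
  have hvd : (v : ℝ) = d⁻¹ := rfl
  have hv0 : v ≠ 0 := by
    rw [← NNReal.coe_ne_zero, hvd]; positivity
  have hsqrt : Real.exp (-Real.log d / 2) = (√d)⁻¹ := by
    rw [Real.sqrt_eq_rpow, Real.rpow_def_of_pos ha, ← Real.exp_neg]; congr 1; ring
  have key : ∀ u : ℝ, gaussianPDFReal 0 1 u * Real.exp (a * u ^ 2 + b * u + c)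
      = Real.exp (c + b ^ 2 / (2 * d) - Real.log d / 2) * gaussianPDFReal (b / d) v u := by
    intro u
    have h1 : Real.exp (c + b ^ 2 / (2 * d) - Real.log d / 2)
        = Real.exp (c + b ^ 2 / (2 * d)) * (√d)⁻¹ := by
      rw [← hsqrt, ← Real.exp_add]; congr 1; ring
    have h2 : (√(2 * Real.pi * d⁻¹))⁻¹ = (√(2 * Real.pi))⁻¹ * √d := by
      rw [Real.sqrt_mul (by positivity), Real.sqrt_inv, mul_inv, inv_inv]
    have h3 : √d ≠ 0 := by positivity
    simp only [gaussianPDFReal, hvd, h1, h2, NNReal.coe_one]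
    rw [show ∀ A B C D : ℝ, A * D⁻¹ * (B * D * C) = (D⁻¹ * D) * (B * (A * C)) by
      intros; ring, inv_mul_cancel₀ h3, one_mul, mul_assoc, ← Real.exp_add, ← Real.exp_add]
    rw [mul_one]
    congr 2
    have : a = (1 - d) / 2 := by rw [hd]; ring
    rw [this]
    field_simp
    ring
  have hint : Integrable (fun u => gaussianPDFReal 0 1 u * Real.exp (a * u ^ 2 + b * u + c)) := by
    simp_rw [key]
    exact (integrable_gaussianPDFReal _ _).const_mul _
  constructor
  · rw [gaussianReal_of_var_ne_zero _ one_ne_zero, gaussianPDF_def,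
      integrable_withDensity_iff_integrable_smul₀' (by fun_prop) (by simp)]
    simpa [ENNReal.toReal_ofReal, gaussianPDFReal_nonneg] using hint
  · rw [integral_gaussianReal_eq_integral_smul one_ne_zero]
    simp_rw [smul_eq_mul, key]
    rw [integral_const_mul, integral_gaussianPDFReal_eq_one _ hv0, mul_one]

lemma iteratedDeriv_pow_mul_zero {f : ℝ → ℝ} {k : ℕ} (hf : ContDiffAt ℝ k f 0) (j : ℕ) :
    iteratedDeriv k (fun t => t ^ j * f t) 0
      = k.descFactorial j * iteratedDeriv (k - j) f 0 := by
  have := iteratedDeriv_mul (n := k) (x := (0 : ℝ)) (f := fun t : ℝ => t ^ j) (g := f)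
    (by fun_prop) hf
  simp only [Pi.mul_def] at this
  rw [this]
  simp only [iteratedDeriv_fun_pow_zero]
  by_cases hj : j ≤ k
  · rw [Finset.sum_eq_single j]
    · rw [if_pos rfl, Nat.descFactorial_eq_factorial_mul_choose]; push_cast; ring
    · intro i _ hij; simp [hij]
    · intro h; simp at h; omega
  · rw [Nat.descFactorial_of_lt (by omega)]
    rw [Finset.sum_eq_zero]
    · simp
    · intro i hi
      have : i ≠ j := by simp at hi; omega
      simp [this]

lemma iteratedDeriv_sum_pow_mul_zero {f : ℝ → ℝ} {k : ℕ} (hf : ContDiffAt ℝ k f 0)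
    (N : ℕ) (c : ℕ → ℝ) :
    iteratedDeriv k (fun t => (∑ j ∈ Finset.range N, c j * t ^ j) * f t) 0
      = ∑ j ∈ Finset.range N, c j * (k.descFactorial j * iteratedDeriv (k - j) f 0) := by
  have h : (fun t => (∑ j ∈ Finset.range N, c j * t ^ j) * f t)
      = fun t => ∑ j ∈ Finset.range N, c j * (t ^ j * f t) := by
    ext t; rw [Finset.sum_mul]; simp_rw [mul_assoc]
  rw [h, iteratedDeriv_fun_sum (fun j _ => by fun_prop)]
  refine Finset.sum_congr rfl fun j _ => ?_
  rw [← iteratedDeriv_pow_mul_zero hf j, iteratedDeriv_const_mul_field]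

lemma cast_descFactorial_succ (k j : ℕ) :
    (k.descFactorial (j + 1) : ℝ) = (k - j) * k.descFactorial j := by
  rw [Nat.descFactorial_succ]
  rcases le_or_gt j k with h | h
  · push_cast [h]; ring
  · simp [Nat.descFactorial_of_lt h]

lemma measurable_productNormal_map (μX μY σX σY ρ : ℝ) :
    Measurable (fun p : ℝ × ℝ =>
      (μX + σX * p.1) * (μY + σY * (ρ * p.1 + Real.sqrt (1 - ρ ^ 2) * p.2))) := by
  fun_prop

instance isProbabilityMeasure_PN (μX μY σX σY ρ : ℝ) :
    IsProbabilityMeasure (PN μX μY σX σY ρ) :=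
  Measure.isProbabilityMeasure_map (measurable_productNormal_map μX μY σX σY ρ).aemeasurable

/-- The moment generating function of the product-normal law, where finite. -/
lemma integrable_and_integral_exp_PN {ρ : ℝ} (σX σY rX rY t w D : ℝ) (hρ : ρ ^ 2 ≤ 1)
    (hw : w = t * (σX * σY)) (hD : D = 1 - 2 * ρ * w - (1 - ρ ^ 2) * w ^ 2) (hD0 : 0 < D) :
    Integrable (fun z => Real.exp (t * z)) (PN (σX * rX) (σY * rY) σX σY ρ) ∧
      ∫ z, Real.exp (t * z) ∂(PN (σX * rX) (σY * rY) σX σY ρ)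
        = Real.exp ((rX * rY * w + (rX ^ 2 + rY ^ 2 - 2 * ρ * rX * rY) / 2 * w ^ 2) / D
            - Real.log D / 2) := by
  have hφ := measurable_productNormal_map (σX * rX) (σY * rY) σX σY ρ
  have hr : Real.sqrt (1 - ρ ^ 2) ^ 2 = 1 - ρ ^ 2 := Real.sq_sqrt (by linarith)
  set r := Real.sqrt (1 - ρ ^ 2)
  have hexp : Measurable (fun z : ℝ => Real.exp (t * z)) := by fun_prop
  have hrw : ∀ u v : ℝ,
      t * ((σX * rX + σX * u) * (σY * rY + σY * (ρ * u + r * v)))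
        = 0 * v ^ 2 + (w * r * (rX + u)) * v + w * (rX + u) * (rY + ρ * u) := by
    intro u v; rw [hw]; ring
  have hin := fun u : ℝ => integrable_and_integral_exp_quadratic_gaussianReal (a := 0)
    (w * r * (rX + u)) (w * (rX + u) * (rY + ρ * u)) (by norm_num)
  have hin' : ∀ u : ℝ,
      ∫ v, Real.exp (0 * v ^ 2 + (w * r * (rX + u)) * v + w * (rX + u) * (rY + ρ * u))
          ∂(gaussianReal 0 1)
        = Real.exp ((w * ρ + w ^ 2 * (1 - ρ ^ 2) / 2) * u ^ 2
          + (w * (rY + ρ * rX) + w ^ 2 * (1 - ρ ^ 2) * rX) * u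
          + (w * rX * rY + w ^ 2 * (1 - ρ ^ 2) * rX ^ 2 / 2)) := by
    intro u
    rw [(hin u).2, ← hr]
    norm_num
    ring
  have hD' : 1 - 2 * (w * ρ + w ^ 2 * (1 - ρ ^ 2) / 2) = D := by rw [hD]; ring
  have hout := integrable_and_integral_exp_quadratic_gaussianReal
    (w * (rY + ρ * rX) + w ^ 2 * (1 - ρ ^ 2) * rX)
    (w * rX * rY + w ^ 2 * (1 - ρ ^ 2) * rX ^ 2 / 2) (hD'.symm ▸ hD0)
  rw [hD'] at hout
  have hprod : Integrable (fun p : ℝ × ℝ => Real.exp (t * ((σX * rX + σX * p.1) *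
      (σY * rY + σY * (ρ * p.1 + r * p.2))))) ((gaussianReal 0 1).prod (gaussianReal 0 1)) := by
    rw [integrable_prod_iff (by fun_prop)]
    simp only [Real.norm_eq_abs, Real.abs_exp, hrw, hin']
    exact ⟨Filter.Eventually.of_forall fun u => (hin u).1, hout.1⟩
  constructor
  · exact (integrable_map_measure hexp.aestronglyMeasurable hφ.aemeasurable).2 hprod
  · rw [PN, integral_map hφ.aemeasurable hexp.aestronglyMeasurable, integral_prod _ hprod]
    simp only [hrw, hin']
    rw [hout.2]
    congr 2
    field_simp
    rw [hD]
    ring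

/-- The moment generating function of the mean shifted by `m`, where finite. -/
lemma integrable_and_integral_exp_PNbar {ρ : ℝ} (σX σY rX rY t w D m : ℝ) (n : ℕ)
    (hρ : ρ ^ 2 ≤ 1)
    (hw : w = t / n * (σX * σY)) (hD : D = 1 - 2 * ρ * w - (1 - ρ ^ 2) * w ^ 2) (hD0 : 0 < D) :
    Integrable (fun x => Real.exp (t * (x - m))) (PNbar n (σX * rX) (σY * rY) σX σY ρ) ∧
      ∫ x, Real.exp (t * (x - m)) ∂(PNbar n (σX * rX) (σY * rY) σX σY ρ)
        = Real.exp (-m * t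
          + n * ((rX * rY * w + (rX ^ 2 + rY ^ 2 - 2 * ρ * rX * rY) / 2 * w ^ 2) / D
            - Real.log D / 2)) := by
  obtain ⟨hint, heq⟩ := integrable_and_integral_exp_PN σX σY rX rY (t / n) w D hρ hw hD hD0
  have hφ : Measurable (fun ω : Fin n → ℝ => (∑ i, ω i) / (n : ℝ)) := by fun_prop
  have hexp : Measurable (fun x : ℝ => Real.exp (t * (x - m))) := by fun_prop
  have hrw : ∀ ω : Fin n → ℝ, Real.exp (t * ((∑ i, ω i) / (n : ℝ) - m))
      = Real.exp (-m * t) * ∏ i, Real.exp (t / n * ω i) := by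
    intro ω
    rw [← Real.exp_sum, ← Finset.mul_sum, ← Real.exp_add]
    congr 1
    ring
  constructor
  · rw [PNbar, integrable_map_measure hexp.aestronglyMeasurable hφ.aemeasurable]
    simp only [Function.comp_def, hrw]
    exact (Integrable.fintype_prod fun _ => hint).const_mul _
  · rw [PNbar, integral_map hφ.aemeasurable hexp.aestronglyMeasurable]
    simp only [hrw]
    rw [integral_const_mul, integral_fintype_prod_eq_prod (fun _ z => Real.exp (t / n * z)), heq]
    simp [← Real.exp_nat_mul, ← Real.exp_add]

lemma hasDerivAt_exp_cgf {ρ s A B m N t D : ℝ}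
    (hD : D = 1 - 2 * ρ * (s * t) - (1 - ρ ^ 2) * (s * t) ^ 2) (hD0 : 0 < D) :
    HasDerivAt (fun t => Real.exp (-m * t
        + N * ((A * (s * t) + B * (s * t) ^ 2)
            / (1 - 2 * ρ * (s * t) - (1 - ρ ^ 2) * (s * t) ^ 2)
          - Real.log (1 - 2 * ρ * (s * t) - (1 - ρ ^ 2) * (s * t) ^ 2) / 2)))
      (Real.exp (-m * t + N * ((A * (s * t) + B * (s * t) ^ 2) / D - Real.log D / 2))
        * (-m + N * s * (((A + 2 * B * (s * t)) * D
            + (A * (s * t) + B * (s * t) ^ 2) * (2 * ρ + 2 * (1 - ρ ^ 2) * (s * t))) / D ^ 2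
          + (ρ + (1 - ρ ^ 2) * (s * t)) / D))) t := by
  have hw : HasDerivAt (fun t => s * t) s t := by simpa using (hasDerivAt_id t).const_mul s
  have hw2 := hw.pow 2
  have hDd := ((hw.const_mul (2 * ρ)).const_sub 1).sub (hw2.const_mul (1 - ρ ^ 2))
  have hE := (hw.const_mul A).add (hw2.const_mul B)
  have hDne : 1 - 2 * ρ * (s * t) - (1 - ρ ^ 2) * (s * t) ^ 2 ≠ 0 := by rw [← hD]; exact hD0.ne'
  have h := (((hasDerivAt_id t).const_mul (-m)).add
    (((hE.div hDd hDne).sub ((hDd.log hDne).div_const 2)).const_mul N)).exp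
  refine h.congr_deriv ?_
  simp [← hD]
  field_simp
  ring

/-- Recursion for the central moments `μₖ = E[(Z̄ₙ - E[Z̄ₙ])ᵏ]` of the mean `Z̄ₙ` of `n`
independent `PN(μX, μY; σX², σY²; ρ)` random variables, where
`E[Z̄ₙ] = μXμY + n sₙ ρ = μXμY + ρσXσY` (with the convention `μₖ = 0` for `k < 0`). -/
theorem central_moment_recursion_PNbar
    (μX μY σX σY ρ : ℝ) (hσX : 0 < σX) (hσY : 0 < σY)
    (hρ₁ : -1 < ρ) (hρ₂ : ρ < 1) (n : ℕ) (hn : 1 ≤ n)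
    (s rX rY : ℝ) (hs : s = σX * σY / n) (hrX : rX = μX / σX) (hrY : rY = μY / σY)
    (M : ℤ → ℝ)
    (hMneg : ∀ k : ℤ, k < 0 → M k = 0)
    (hMnat : ∀ k : ℕ,
      M k = ∫ x, (x - (μX * μY + n * s * ρ)) ^ k ∂(PNbar n μX μY σX σY ρ)) :
    ∀ k : ℕ,
      M (k + 1)
        = 4 * ρ * s * k * M k
          - s * k * (s * (6 * ρ ^ 2 - 2) * (k - 1)
              + n * s * (2 * ρ * rX * rY - rX ^ 2 - rY ^ 2 + 3 * ρ ^ 2 - 1)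
              - 4 * ρ * (μX * μY + n * s * ρ)) * M (k - 1)
          - s ^ 2 * k * (k - 1) * ((6 * ρ ^ 2 - 2) * (μX * μY + n * s * ρ)
              + n * s * (ρ * rY ^ 2 - ρ ^ 2 * rX * rY - rX * rY + ρ * rX ^ 2
                  + 3 * ρ * (1 - ρ ^ 2))
              + 4 * s * ρ * (1 - ρ ^ 2) * (k - 2)) * M (k - 2)
          - s ^ 3 * (1 - ρ ^ 2) * k * (k - 1) * (k - 2)
            * (4 * ρ * (μX * μY + n * s * ρ) + s * (1 - ρ ^ 2) * (n + k - 3)) * M (k - 3)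
          - s ^ 4 * (1 - ρ ^ 2) ^ 2 * k * (k - 1) * (k - 2) * (k - 3)
            * (μX * μY + n * s * ρ) * M (k - 4) := by
  intro k
  have hn0 : (n : ℝ) ≠ 0 := by positivity
  have hρ : ρ ^ 2 ≤ 1 := by nlinarith
  obtain rfl : μX = σX * rX := by rw [hrX]; field_simp
  obtain rfl : μY = σY * rY := by rw [hrY]; field_simp
  have hns : σX * σY = n * s := by rw [hs]; field_simp
  have hA : σX * rX * (σY * rY) = n * s * (rX * rY) := by rw [← hns]; ring
  set m := σX * rX * (σY * rY) + n * s * ρ with hm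
  set P := PNbar n (σX * rX) (σY * rY) σX σY ρ
  set G := mgf (fun x => x - m) P with hG
  set D : ℝ → ℝ := fun t => 1 - 2 * ρ * (s * t) - (1 - ρ ^ 2) * (s * t) ^ 2 with hD
  have hDpos : ∀ᶠ t in nhds (0 : ℝ), 0 < D t := by
    have : ContinuousAt D 0 := by fun_prop
    exact this.eventually (lt_mem_nhds (by simp [hD]))
  have hmgf : ∀ t, 0 < D t → _ := fun t ht =>
    integrable_and_integral_exp_PNbar σX σY rX rY t (s * t) (D t) m n hρ
      (by rw [hns]; field_simp) rfl ht
  have h0 : (0 : ℝ) ∈ interior (integrableExpSet (fun x => x - m) P) :=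
    mem_interior_iff_mem_nhds.2 (hDpos.mono fun t ht => (hmgf t ht).1)
  have hGan : AnalyticAt ℝ G 0 := analyticAt_mgf h0
  have hmom : ∀ j : ℕ, iteratedDeriv j G 0 = M j := by
    intro j
    rw [hG, iteratedDeriv_mgf_zero h0, hMnat]
    rfl
  set B := (rX ^ 2 + rY ^ 2 - 2 * ρ * rX * rY) / 2 with hB
  set q := 1 - ρ ^ 2 with hq
  set c : ℕ → ℝ := fun j => ([1, -4 * ρ * s, (6 * ρ ^ 2 - 2) * s ^ 2, 4 * ρ * q * s ^ 3,
    q ^ 2 * s ^ 4] : List ℝ).getD j 0 with hc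
  set d : ℕ → ℝ := fun j => ([0, s * (4 * ρ * m + n * s * (2 * B + 1 - 3 * ρ ^ 2)),
    s ^ 2 * (-m * (6 * ρ ^ 2 - 2) + n * s * (q * (rX * rY) - 2 * ρ * B - 3 * ρ * q)),
    s ^ 3 * (-4 * ρ * q * m - n * s * q ^ 2), - s ^ 4 * q ^ 2 * m] : List ℝ).getD j 0 with hd
  have hode : (fun t => (∑ j ∈ Finset.range 5, c j * t ^ j) * deriv G t)
      =ᶠ[nhds 0] fun t => (∑ j ∈ Finset.range 5, d j * t ^ j) * G t := by
    have hev := hDpos.eventually_nhds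
    filter_upwards [hev] with t ht
    have htpos : 0 < D t := ht.self_of_nhds
    have hGeq : G =ᶠ[nhds t] _ := ht.mono fun u hu => (hmgf u hu).2
    rw [((hasDerivAt_exp_cgf rfl htpos).congr_of_eventuallyEq hGeq).deriv, hGeq.self_of_nhds]
    have hDne : D t ≠ 0 := htpos.ne'
    have hDt : D t = 1 - 2 * ρ * (s * t) - q * (s * t) ^ 2 := rfl
    have hcD : ∑ j ∈ Finset.range 5, c j * t ^ j = D t ^ 2 := by
      simp [Finset.sum_range_succ, hc, hDt, hq]; ring
    rw [hcD, mul_left_comm, mul_comm]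
    congr 1
    rw [← hq]
    have hrat : D t ^ 2 * (-m + n * s * (((rX * rY + 2 * B * (s * t)) * D t
            + (rX * rY * (s * t) + B * (s * t) ^ 2) * (2 * ρ + 2 * q * (s * t))) / D t ^ 2
          + (ρ + q * (s * t)) / D t))
        = -m * D t ^ 2 + n * s * (((rX * rY + 2 * B * (s * t)) * D t
            + (rX * rY * (s * t) + B * (s * t) ^ 2) * (2 * ρ + 2 * q * (s * t)))
          + (ρ + q * (s * t)) * D t) := by
      field_simp
    rw [hrat]
    simp [Finset.sum_range_succ, hd]
    rw [hDt, hm, hA, hq]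
    ring
  have hk := hode.iteratedDeriv_eq k
  rw [iteratedDeriv_sum_pow_mul_zero hGan.deriv.contDiffAt,
    iteratedDeriv_sum_pow_mul_zero hGan.contDiffAt] at hk
  simp only [← iteratedDeriv_succ', hmom] at hk
  have hshift : ∀ (j : ℕ) (i : ℤ), (k.descFactorial j : ℝ) * M ((k - j : ℕ) + i)
      = k.descFactorial j * M (k + (i - j)) := by
    intro j i
    rcases le_or_gt j k with h | h
    · congr 2; push_cast [h]; ring
    · simp [Nat.descFactorial_of_lt h]
  have hshift0 := fun j => hshift j 0
  simp only [add_zero] at hshift0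
  push_cast at hk
  simp only [hshift, hshift0] at hk
  simp only [Finset.sum_range_succ, hc, hd, cast_descFactorial_succ, Nat.descFactorial_zero] at hk
  norm_num at hk
  simp only [show ∀ a b : ℤ, a - b = a + -b from fun _ _ => rfl]
  clear_value B q m
  rw [hB] at hk
  linear_combination hk + s ^ 2 * n * s * k * (k - 1) * rX * rY * M (k + -2) * hq
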